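/- Theorem 3: the axiom system E_SM = {(E1),(E2),(E3),(E4),(E5),(E6),(E10),(E11)} is a complete set of axioms for the multiset semantics for standard attack trees: for all standard attack trees t and t', ⟦t⟧_M = ⟦t'⟧_M if and only if the equation t = t' is a syntactic consequence of E_SM. -/

import Mathlib

/-!
Formalization of "Attack Trees with Sequential Conjunction".

Source-sink graphs over a set `B` of basic actions: a vertex type `V`,
a multiset of labeled edges, a source `s` and a sink `z` with `s ≠ z`.
-/

structure SSG (B : Type) : Type 1 where
  V : Type
  deq : DecidableEq V
  E : Multiset (V × B × V)
  s : V
  z : V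
  ne : s ≠ z

namespace SSG

variable {B : Type}

/-- The graph with a single edge labeled `b`. -/
def single (b : B) : SSG B where
  V := Bool
  deq := inferInstance
  E := {(false, b, true)}
  s := false
  z := true
  ne := Bool.false_ne_true

/-- In the sequential composition, the sink of the first graph is identified with
the source of the second graph. -/
def seqEmbed (G G' : SSG B) (v : G.V) : ({u : G.V // u ≠ G.z} ⊕ G'.V) :=
  haveI := G.deq
  if h : v = G.z then Sum.inr G'.s else Sum.inl ⟨v, h⟩

/-- Sequential composition `G ⋅ G'` of source-sink graphs: the disjoint union in which
the sink of `G` is identified with the source of `G'`. -/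
def seq (G G' : SSG B) : SSG B where
  V := {u : G.V // u ≠ G.z} ⊕ G'.V
  deq := by haveI := G.deq; haveI := G'.deq; infer_instance
  E := G.E.map (fun e => (G.seqEmbed G' e.1, e.2.1, G.seqEmbed G' e.2.2)) +
       G'.E.map (fun e => (Sum.inr e.1, e.2.1, Sum.inr e.2.2))
  s := Sum.inl ⟨G.s, G.ne⟩
  z := Sum.inr G'.z
  ne := by simp

/-- In the parallel composition, the two sources are identified and the two sinks
are identified. -/
def parEmbed (G G' : SSG B) (v : G.V) : ({u : G.V // u ≠ G.s ∧ u ≠ G.z} ⊕ G'.V) :=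
  haveI := G.deq
  if hs : v = G.s then Sum.inr G'.s
  else if hz : v = G.z then Sum.inr G'.z
  else Sum.inl ⟨v, hs, hz⟩

/-- Parallel composition `G ∥ G'` of source-sink graphs: the disjoint union in which
the two sources are identified and the two sinks are identified. -/
def par (G G' : SSG B) : SSG B where
  V := {u : G.V // u ≠ G.s ∧ u ≠ G.z} ⊕ G'.V
  deq := by haveI := G.deq; haveI := G'.deq; infer_instance
  E := G.E.map (fun e => (G.parEmbed G' e.1, e.2.1, G.parEmbed G' e.2.2)) +
       G'.E.map (fun e => (Sum.inr e.1, e.2.1, Sum.inr e.2.2))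
  s := Sum.inr G'.s
  z := Sum.inr G'.z
  ne := fun h => G'.ne (Sum.inr_injective h)

/-- Two source-sink graphs are equal (isomorphic) if there is a bijection between their
vertex sets that preserves the labeled edges (and hence source and sink). -/
def Iso (G G' : SSG B) : Prop :=
  ∃ f : G.V ≃ G'.V,
    G.E.map (fun e => (f e.1, e.2.1, f e.2.2)) = G'.E ∧ f G.s = G'.s ∧ f G.z = G'.z

/-- Directed adjacency: there is an edge from `u` to `v`. -/
def Adj (G : SSG B) (u v : G.V) : Prop := ∃ b, (u, b, v) ∈ G.E

/-- Series-parallel graphs (SP graphs): built from single edges by sequential and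
parallel composition; as SP graphs are considered up to isomorphism, the collection
is closed under isomorphism. -/
inductive IsSP : SSG B → Prop
  | single (b : B) : IsSP (single b)
  | seq {G G' : SSG B} : IsSP G → IsSP G' → IsSP (G.seq G')
  | par {G G' : SSG B} : IsSP G → IsSP G' → IsSP (G.par G')
  | iso {G G' : SSG B} : IsSP G → G.Iso G' → IsSP G'

/-- A graph is connected if any two vertices are joined by a path in the
underlying undirected graph. -/
def Connected (G : SSG B) : Prop :=
  ∀ u v : G.V, Relation.ReflTransGen (fun a b => G.Adj a b ∨ G.Adj b a) u v

/-- A directed graph is acyclic if it has no (nonempty) directed cycle. -/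
def Acyclic (G : SSG B) : Prop := ∀ v : G.V, ¬ Relation.TransGen G.Adj v v

end SSG
/-!
SAND attack trees: closed terms over `B ∪ {OR, AND, SAND}`, where the unranked
operators take `k ≥ 1` arguments (represented by nonempty lists `SandTreeList`).
-/

mutual
inductive SandTree (B : Type) : Type
  | atom : B → SandTree B
  | or : SandTreeList B → SandTree B
  | and : SandTreeList B → SandTree B
  | sand : SandTreeList B → SandTree B
inductive SandTreeList (B : Type) : Type
  | single : SandTree B → SandTreeList B
  | cons : SandTree B → SandTreeList B → SandTreeList B
end

namespace SandTreeList

variable {B : Type}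

def toList : SandTreeList B → List (SandTree B)
  | .single t => [t]
  | .cons t ts => t :: ts.toList

/-- Prepend a (possibly empty) list of trees to a nonempty argument list. -/
def glue : List (SandTree B) → SandTreeList B → SandTreeList B
  | [], ys => ys
  | x :: xs, ys => .cons x (glue xs ys)

/-- The nonempty argument list `t :: l`. -/
def ofList : SandTree B → List (SandTree B) → SandTreeList B
  | t, [] => .single t
  | t, u :: us => .cons t (ofList u us)

/-- Append a (possibly empty) list of trees to a nonempty argument list. -/
def snoc : SandTreeList B → List (SandTree B) → SandTreeList B
  | .single t, zs => ofList t zs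
  | .cons t ts, zs => .cons t (snoc ts zs)

def map (f : SandTree B → SandTree B) : SandTreeList B → SandTreeList B
  | .single t => .single (f t)
  | .cons t ts => .cons (f t) (map f ts)

end SandTreeList

/-!
The SP semantics `sem` interprets a SAND attack tree as a set of SP graphs
(sets of source-sink graphs closed under isomorphism, since SP graphs are
considered up to isomorphism):
`⟦b⟧ = {→b}`, `⟦OR(t₁,…,t_k)⟧ = ⋃ᵢ ⟦tᵢ⟧`,
`⟦AND(t₁,…,t_k)⟧ = {G₁ ∥ … ∥ G_k | Gᵢ ∈ ⟦tᵢ⟧}`,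
`⟦SAND(t₁,…,t_k)⟧ = {G₁ ⋅ … ⋅ G_k | Gᵢ ∈ ⟦tᵢ⟧}`.
-/

mutual
def sem {B : Type} : SandTree B → Set (SSG B)
  | .atom b => {G | (SSG.single b).Iso G}
  | .or ts => semOr ts
  | .and ts => semAnd ts
  | .sand ts => semSand ts
def semOr {B : Type} : SandTreeList B → Set (SSG B)
  | .single t => sem t
  | .cons t ts => sem t ∪ semOr ts
def semAnd {B : Type} : SandTreeList B → Set (SSG B)
  | .single t => sem t
  | .cons t ts => {G | ∃ G1 ∈ sem t, ∃ G2 ∈ semAnd ts, (G1.par G2).Iso G}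
def semSand {B : Type} : SandTreeList B → Set (SSG B)
  | .single t => sem t
  | .cons t ts => {G | ∃ G1 ∈ sem t, ∃ G2 ∈ semSand ts, (G1.seq G2).Iso G}
end
/-!
Equality of terms modulo commutativity of the unranked operators `OR` and `AND`
(the congruence generated by permuting the arguments of `OR` and `AND` nodes).
-/

mutual
inductive PEq {B : Type} : SandTree B → SandTree B → Prop
  | refl (t : SandTree B) : PEq t t
  | symm {t u : SandTree B} : PEq t u → PEq u t
  | trans {t u v : SandTree B} : PEq t u → PEq u v → PEq t v
  | orPerm {ts ts' : SandTreeList B} : ts.toList.Perm ts'.toList → PEq (.or ts) (.or ts')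
  | andPerm {ts ts' : SandTreeList B} : ts.toList.Perm ts'.toList → PEq (.and ts) (.and ts')
  | orCongr {ts ts' : SandTreeList B} : PEqL ts ts' → PEq (.or ts) (.or ts')
  | andCongr {ts ts' : SandTreeList B} : PEqL ts ts' → PEq (.and ts) (.and ts')
  | sandCongr {ts ts' : SandTreeList B} : PEqL ts ts' → PEq (.sand ts) (.sand ts')
inductive PEqL {B : Type} : SandTreeList B → SandTreeList B → Prop
  | single {t t' : SandTree B} : PEq t t' → PEqL (.single t) (.single t')
  | cons {t t' : SandTree B} {ts ts' : SandTreeList B} :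
      PEq t t' → PEqL ts ts' → PEqL (.cons t ts) (.cons t' ts')
end
/-!
Syntactic consequence from the axiom system `E_SP`.

The axiom schemes are represented by all of their instances (arbitrary argument
terms in place of the variable vectors `X⃗`, `Y⃗`, `Z⃗`); on closed terms this
generates exactly the same derivability relation as variables plus the
substitution rule.  Closure under "replacement in contexts" is represented by
the congruence rules for the three operators.
-/

section
open SandTreeList
mutual
inductive DerivSP {B : Type} : SandTree B → SandTree B → Prop
  /- closure rules -/
  | refl (t : SandTree B) : DerivSP t t
  | symm {t u : SandTree B} : DerivSP t u → DerivSP u t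
  | trans {t u v : SandTree B} : DerivSP t u → DerivSP u v → DerivSP t v
  | congrOr {ts ts' : SandTreeList B} : DerivSPL ts ts' → DerivSP (.or ts) (.or ts')
  | congrAnd {ts ts' : SandTreeList B} : DerivSPL ts ts' → DerivSP (.and ts) (.and ts')
  | congrSand {ts ts' : SandTreeList B} : DerivSPL ts ts' → DerivSP (.sand ts) (.sand ts')
  /- (E1) commutativity of OR -/
  | ax1 {ts ts' : SandTreeList B} : ts.toList.Perm ts'.toList → DerivSP (.or ts) (.or ts')
  /- (E2) commutativity of AND -/
  | ax2 {ts ts' : SandTreeList B} : ts.toList.Perm ts'.toList → DerivSP (.and ts) (.and ts')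
  /- (E3) OR(X⃗, OR(Y⃗)) = OR(X⃗, Y⃗) -/
  | ax3 (xs : List (SandTree B)) (ys : SandTreeList B) :
      DerivSP (.or (glue xs (.single (.or ys)))) (.or (glue xs ys))
  /- (E4) AND(X⃗, AND(Y⃗)) = AND(X⃗, Y⃗) -/
  | ax4 (xs : List (SandTree B)) (ys : SandTreeList B) :
      DerivSP (.and (glue xs (.single (.and ys)))) (.and (glue xs ys))
  /- (E4') SAND(X⃗, SAND(Y⃗), Z⃗) = SAND(X⃗, Y⃗, Z⃗) -/
  | ax4' (xs : List (SandTree B)) (ys : SandTreeList B) (zs : List (SandTree B)) :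
      DerivSP (.sand (glue xs (snoc (.single (.sand ys)) zs))) (.sand (glue xs (snoc ys zs)))
  /- (E5) OR(A) = A -/
  | ax5 (t : SandTree B) : DerivSP (.or (.single t)) t
  /- (E6) AND(A) = A -/
  | ax6 (t : SandTree B) : DerivSP (.and (.single t)) t
  /- (E6') SAND(A) = A -/
  | ax6' (t : SandTree B) : DerivSP (.sand (.single t)) t
  /- (E10) AND(X⃗, OR(Y⃗)) = OR(AND(X⃗,Y₁),…,AND(X⃗,Yₗ)) -/
  | ax10 (xs : List (SandTree B)) (ys : SandTreeList B) :
      DerivSP (.and (glue xs (.single (.or ys))))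
        (.or (SandTreeList.map (fun y => .and (glue xs (.single y))) ys))
  /- (E10') SAND(X⃗, OR(Y⃗), Z⃗) = OR(SAND(X⃗,Y₁,Z⃗),…,SAND(X⃗,Yₗ,Z⃗)) -/
  | ax10' (xs : List (SandTree B)) (ys : SandTreeList B) (zs : List (SandTree B)) :
      DerivSP (.sand (glue xs (snoc (.single (.or ys)) zs)))
        (.or (SandTreeList.map (fun y => .sand (glue xs (snoc (.single y) zs))) ys))
  /- (E11) OR(A, A, X⃗) = OR(A, X⃗) -/
  | ax11 (a : SandTree B) (xs : List (SandTree B)) :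
      DerivSP (.or (.cons a (ofList a xs))) (.or (ofList a xs))
inductive DerivSPL {B : Type} : SandTreeList B → SandTreeList B → Prop
  | single {t t' : SandTree B} : DerivSP t t' → DerivSPL (.single t) (.single t')
  | cons {t t' : SandTree B} {ts ts' : SandTreeList B} :
      DerivSP t t' → DerivSPL ts ts' → DerivSPL (.cons t ts) (.cons t' ts')
end
end

/-! Syntactic consequence from the SAND-free fragment
`E_SM = {E1, E2, E3, E4, E5, E6, E10, E11}` of `E_SP` (formulated over the full
signature of SAND attack trees). -/
section
open SandTreeList
mutual
inductive DerivSM {B : Type} : SandTree B → SandTree B → Prop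
  | refl (t : SandTree B) : DerivSM t t
  | symm {t u : SandTree B} : DerivSM t u → DerivSM u t
  | trans {t u v : SandTree B} : DerivSM t u → DerivSM u v → DerivSM t v
  | congrOr {ts ts' : SandTreeList B} : DerivSML ts ts' → DerivSM (.or ts) (.or ts')
  | congrAnd {ts ts' : SandTreeList B} : DerivSML ts ts' → DerivSM (.and ts) (.and ts')
  | congrSand {ts ts' : SandTreeList B} : DerivSML ts ts' → DerivSM (.sand ts) (.sand ts')
  | ax1 {ts ts' : SandTreeList B} : ts.toList.Perm ts'.toList → DerivSM (.or ts) (.or ts')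
  | ax2 {ts ts' : SandTreeList B} : ts.toList.Perm ts'.toList → DerivSM (.and ts) (.and ts')
  | ax3 (xs : List (SandTree B)) (ys : SandTreeList B) :
      DerivSM (.or (glue xs (.single (.or ys)))) (.or (glue xs ys))
  | ax4 (xs : List (SandTree B)) (ys : SandTreeList B) :
      DerivSM (.and (glue xs (.single (.and ys)))) (.and (glue xs ys))
  | ax5 (t : SandTree B) : DerivSM (.or (.single t)) t
  | ax6 (t : SandTree B) : DerivSM (.and (.single t)) t
  | ax10 (xs : List (SandTree B)) (ys : SandTreeList B) :
      DerivSM (.and (glue xs (.single (.or ys))))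
        (.or (SandTreeList.map (fun y => .and (glue xs (.single y))) ys))
  | ax11 (a : SandTree B) (xs : List (SandTree B)) :
      DerivSM (.or (.cons a (ofList a xs))) (.or (ofList a xs))
inductive DerivSML {B : Type} : SandTreeList B → SandTreeList B → Prop
  | single {t t' : SandTree B} : DerivSM t t' → DerivSML (.single t) (.single t')
  | cons {t t' : SandTree B} {ts ts' : SandTreeList B} :
      DerivSM t t' → DerivSML ts ts' → DerivSML (.cons t ts) (.cons t' ts')
end
end
/-!
The normal-form grammar (for `k ≥ 2`, `b ∈ B`):
`N ::= A | OR(A₁,…,A_k)` (with pairwise distinct `Aᵢ`),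
`A ::= C | S`, `C ::= b | AND(S₁,…,S_k)`, `S ::= b | SAND(C₁,…,C_k)`.
-/

mutual
inductive IsC {B : Type} : SandTree B → Prop
  | atom (b : B) : IsC (.atom b)
  | and {ts : SandTreeList B} : 2 ≤ ts.toList.length → IsSL ts → IsC (.and ts)
inductive IsS {B : Type} : SandTree B → Prop
  | atom (b : B) : IsS (.atom b)
  | sand {ts : SandTreeList B} : 2 ≤ ts.toList.length → IsCL ts → IsS (.sand ts)
inductive IsSL {B : Type} : SandTreeList B → Prop
  | single {t : SandTree B} : IsS t → IsSL (.single t)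
  | cons {t : SandTree B} {ts : SandTreeList B} : IsS t → IsSL ts → IsSL (.cons t ts)
inductive IsCL {B : Type} : SandTreeList B → Prop
  | single {t : SandTree B} : IsC t → IsCL (.single t)
  | cons {t : SandTree B} {ts : SandTreeList B} : IsC t → IsCL ts → IsCL (.cons t ts)
end

/-- Terms generated by the non-terminal `A` of the normal-form grammar. -/
def IsA {B : Type} (t : SandTree B) : Prop := IsC t ∨ IsS t

/-- Terms generated by the non-terminal `N` of the normal-form grammar; as terms
are considered modulo commutativity of `OR` and `AND`, the arguments of the `OR`
are required to be pairwise distinct modulo commutativity. -/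
def IsN {B : Type} (t : SandTree B) : Prop :=
  IsA t ∨ ∃ ts : SandTreeList B, t = .or ts ∧ 2 ≤ ts.toList.length ∧
    (∀ u ∈ ts.toList, IsA u) ∧ ts.toList.Pairwise (fun a b => ¬ PEq a b)

/-!
The term rewriting system obtained by orienting the axioms
(E3), (E4), (E4'), (E5), (E6), (E6'), (E10), (E10'), (E11) from left to right,
applied in any context, modulo commutativity of `OR` and `AND`.
-/

section
open SandTreeList

/-- Rule application at the root. -/
inductive RStep {B : Type} : SandTree B → SandTree B → Prop
  | r3 (xs : List (SandTree B)) (ys : SandTreeList B) :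
      RStep (.or (glue xs (.single (.or ys)))) (.or (glue xs ys))
  | r4 (xs : List (SandTree B)) (ys : SandTreeList B) :
      RStep (.and (glue xs (.single (.and ys)))) (.and (glue xs ys))
  | r4' (xs : List (SandTree B)) (ys : SandTreeList B) (zs : List (SandTree B)) :
      RStep (.sand (glue xs (snoc (.single (.sand ys)) zs))) (.sand (glue xs (snoc ys zs)))
  | r5 (t : SandTree B) : RStep (.or (.single t)) t
  | r6 (t : SandTree B) : RStep (.and (.single t)) t
  | r6' (t : SandTree B) : RStep (.sand (.single t)) t
  | r10 (xs : List (SandTree B)) (ys : SandTreeList B) :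
      RStep (.and (glue xs (.single (.or ys))))
        (.or (SandTreeList.map (fun y => .and (glue xs (.single y))) ys))
  | r10' (xs : List (SandTree B)) (ys : SandTreeList B) (zs : List (SandTree B)) :
      RStep (.sand (glue xs (snoc (.single (.or ys)) zs)))
        (.or (SandTreeList.map (fun y => .sand (glue xs (snoc (.single y) zs))) ys))
  | r11 (a : SandTree B) (xs : List (SandTree B)) :
      RStep (.or (.cons a (ofList a xs))) (.or (ofList a xs))

end

/-! Rule application in an arbitrary context. -/
mutual
inductive Rw {B : Type} : SandTree B → SandTree B → Prop
  | root {t t' : SandTree B} : RStep t t' → Rw t t'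
  | or {ts ts' : SandTreeList B} : RwL ts ts' → Rw (.or ts) (.or ts')
  | and {ts ts' : SandTreeList B} : RwL ts ts' → Rw (.and ts) (.and ts')
  | sand {ts ts' : SandTreeList B} : RwL ts ts' → Rw (.sand ts) (.sand ts')
inductive RwL {B : Type} : SandTreeList B → SandTreeList B → Prop
  | single {t t' : SandTree B} : Rw t t' → RwL (.single t) (.single t')
  | head {t t' : SandTree B} {ts : SandTreeList B} : Rw t t' → RwL (.cons t ts) (.cons t' ts)
  | tail {t : SandTree B} {ts ts' : SandTreeList B} : RwL ts ts' → RwL (.cons t ts) (.cons t ts')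
end

/-- One rewrite step of the TRS `⇒`, working modulo commutativity of `OR` and `AND`. -/
def RwMod {B : Type} (t t' : SandTree B) : Prop :=
  ∃ u u' : SandTree B, PEq t u ∧ Rw u u' ∧ PEq u' t'

/-- Zero or more rewrite steps (modulo commutativity of `OR` and `AND`). -/
def RwStar {B : Type} : SandTree B → SandTree B → Prop :=
  Relation.ReflTransGen (fun a b => PEq a b ∨ Rw a b)

/-- A normal form: no rewrite rule is applicable, modulo commutativity of `OR` and `AND`. -/
def NormalForm {B : Type} (t : SandTree B) : Prop :=
  ∀ u t' : SandTree B, PEq t u → ¬ Rw u t'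

/-! The norm `‖·‖`: `‖b‖ = 1`, `‖OR(t₁,…,t_k)‖ = ‖t₁‖+…+‖t_k‖+2`,
`‖AND(t₁,…,t_k)‖ = ‖SAND(t₁,…,t_k)‖ = 2·‖t₁‖·…·‖t_k‖`. -/
mutual
def weight {B : Type} : SandTree B → ℕ
  | .atom _ => 1
  | .or ts => weightSum ts + 2
  | .and ts => 2 * weightProd ts
  | .sand ts => 2 * weightProd ts
def weightSum {B : Type} : SandTreeList B → ℕ
  | .single t => weight t
  | .cons t ts => weight t + weightSum ts
def weightProd {B : Type} : SandTreeList B → ℕ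
  | .single t => weight t
  | .cons t ts => weight t * weightProd ts
end
/-!
Standard attack trees are SAND attack trees containing no `SAND` operator.
The multiset semantics maps a standard attack tree to a set of finite multisets
over `B`: `⟦b⟧_M = {⟨b⟩}`, `⟦OR⟧_M = ⋃ᵢ ⟦tᵢ⟧_M`,
`⟦AND⟧_M = {M₁ ⊎ … ⊎ M_k | Mᵢ ∈ ⟦tᵢ⟧_M}`.
(Its value on trees containing `SAND` is irrelevant and set to `∅`.)
-/

mutual
inductive NoSand {B : Type} : SandTree B → Prop
  | atom (b : B) : NoSand (.atom b)
  | or {ts : SandTreeList B} : NoSandL ts → NoSand (.or ts)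
  | and {ts : SandTreeList B} : NoSandL ts → NoSand (.and ts)
inductive NoSandL {B : Type} : SandTreeList B → Prop
  | single {t : SandTree B} : NoSand t → NoSandL (.single t)
  | cons {t : SandTree B} {ts : SandTreeList B} : NoSand t → NoSandL ts → NoSandL (.cons t ts)
end

mutual
def msem {B : Type} : SandTree B → Set (Multiset B)
  | .atom b => {({b} : Multiset B)}
  | .or ts => msemOr ts
  | .and ts => msemAnd ts
  | .sand _ => ∅
def msemOr {B : Type} : SandTreeList B → Set (Multiset B)
  | .single t => msem t
  | .cons t ts => msem t ∪ msemOr ts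
def msemAnd {B : Type} : SandTreeList B → Set (Multiset B)
  | .single t => msem t
  | .cons t ts => {M | ∃ M1 ∈ msem t, ∃ M2 ∈ msemAnd ts, M = M1 + M2}
end

/-- Parallel composition of a nonempty list of graphs `G ∥ H₁ ∥ … ∥ H_k`. -/
def parAll {B : Type} : SSG B → List (SSG B) → SSG B
  | G, [] => G
  | G, H :: Hs => parAll (G.par H) Hs

/-- SAND attack trees modulo equivalence with respect to the SP semantics
(`t ~ t'` iff `⟦t⟧ = ⟦t'⟧`). -/
def semSetoid (B : Type) : Setoid (SandTree B) :=
  ⟨fun t t' => sem t = sem t', fun _ => rfl, Eq.symm, Eq.trans⟩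

/-- The map induced by the SP semantics on equivalence classes of SAND attack trees. -/
def semClass {B : Type} : Quotient (semSetoid B) → Set (SSG B) :=
  Quotient.lift sem (fun _ _ h => h)

/-!
Bottom-up evaluation of the minimal attack time attribute on SAND attack trees:
`α(b) = β(b)`, `α(OR) = min`, `α(AND) = max`, `α(SAND) = Σ`.
-/

mutual
def attr {B : Type} (β : B → NNReal) : SandTree B → NNReal
  | .atom b => β b
  | .or ts => attrOr β ts
  | .and ts => attrAnd β ts
  | .sand ts => attrSand β ts
def attrOr {B : Type} (β : B → NNReal) : SandTreeList B → NNReal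
  | .single t => attr β t
  | .cons t ts => min (attr β t) (attrOr β ts)
def attrAnd {B : Type} (β : B → NNReal) : SandTreeList B → NNReal
  | .single t => attr β t
  | .cons t ts => max (attr β t) (attrAnd β ts)
def attrSand {B : Type} (β : B → NNReal) : SandTreeList B → NNReal
  | .single t => attr β t
  | .cons t ts => attr β t + attrSand β ts
end
/-!
Standard attack trees as a standalone signature (`B ∪ {OR, AND}`, unranked
operators with `k ≥ 1` arguments), their multiset semantics, and syntactic
consequence from the axiom system `E_SM`.
-/

mutual
inductive ATree (B : Type) : Type
  | atom : B → ATree B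
  | or : ATreeList B → ATree B
  | and : ATreeList B → ATree B
inductive ATreeList (B : Type) : Type
  | single : ATree B → ATreeList B
  | cons : ATree B → ATreeList B → ATreeList B
end

namespace ATreeList

variable {B : Type}

def toList : ATreeList B → List (ATree B)
  | .single t => [t]
  | .cons t ts => t :: ts.toList

def glue : List (ATree B) → ATreeList B → ATreeList B
  | [], ys => ys
  | x :: xs, ys => .cons x (glue xs ys)

def ofList : ATree B → List (ATree B) → ATreeList B
  | t, [] => .single t
  | t, u :: us => .cons t (ofList u us)

def map (f : ATree B → ATree B) : ATreeList B → ATreeList B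
  | .single t => .single (f t)
  | .cons t ts => .cons (f t) (map f ts)

end ATreeList

/-! The multiset semantics of standard attack trees. -/

mutual
def amsem {B : Type} : ATree B → Set (Multiset B)
  | .atom b => {({b} : Multiset B)}
  | .or ts => amsemOr ts
  | .and ts => amsemAnd ts
def amsemOr {B : Type} : ATreeList B → Set (Multiset B)
  | .single t => amsem t
  | .cons t ts => amsem t ∪ amsemOr ts
def amsemAnd {B : Type} : ATreeList B → Set (Multiset B)
  | .single t => amsem t
  | .cons t ts => {M | ∃ M1 ∈ amsem t, ∃ M2 ∈ amsemAnd ts, M = M1 + M2}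
end

/-!
Syntactic consequence from `E_SM = {E1, E2, E3, E4, E5, E6, E10, E11}`.
Axiom schemes are represented by all of their instances (closure under
substitution is then automatic), and closure under replacement in contexts is
represented by the congruence rules.
-/

section
open ATreeList
mutual
inductive DerivASM {B : Type} : ATree B → ATree B → Prop
  | refl (t : ATree B) : DerivASM t t
  | symm {t u : ATree B} : DerivASM t u → DerivASM u t
  | trans {t u v : ATree B} : DerivASM t u → DerivASM u v → DerivASM t v
  | congrOr {ts ts' : ATreeList B} : DerivASML ts ts' → DerivASM (.or ts) (.or ts')
  | congrAnd {ts ts' : ATreeList B} : DerivASML ts ts' → DerivASM (.and ts) (.and ts')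
  /- (E1) -/
  | ax1 {ts ts' : ATreeList B} : ts.toList.Perm ts'.toList → DerivASM (.or ts) (.or ts')
  /- (E2) -/
  | ax2 {ts ts' : ATreeList B} : ts.toList.Perm ts'.toList → DerivASM (.and ts) (.and ts')
  /- (E3) -/
  | ax3 (xs : List (ATree B)) (ys : ATreeList B) :
      DerivASM (.or (glue xs (.single (.or ys)))) (.or (glue xs ys))
  /- (E4) -/
  | ax4 (xs : List (ATree B)) (ys : ATreeList B) :
      DerivASM (.and (glue xs (.single (.and ys)))) (.and (glue xs ys))
  /- (E5) -/
  | ax5 (t : ATree B) : DerivASM (.or (.single t)) t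
  /- (E6) -/
  | ax6 (t : ATree B) : DerivASM (.and (.single t)) t
  /- (E10) -/
  | ax10 (xs : List (ATree B)) (ys : ATreeList B) :
      DerivASM (.and (glue xs (.single (.or ys))))
        (.or (ATreeList.map (fun y => .and (glue xs (.single y))) ys))
  /- (E11) -/
  | ax11 (a : ATree B) (xs : List (ATree B)) :
      DerivASM (.or (.cons a (ofList a xs))) (.or (ofList a xs))
inductive DerivASML {B : Type} : ATreeList B → ATreeList B → Prop
  | single {t t' : ATree B} : DerivASM t t' → DerivASML (.single t) (.single t')
  | cons {t t' : ATree B} {ts ts' : ATreeList B} :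
      DerivASM t t' → DerivASML ts ts' → DerivASML (.cons t ts) (.cons t' ts')
end
end

open scoped Pointwise

namespace ATreeList

variable {B : Type}

@[simp] theorem toList_single (t : ATree B) : (single t).toList = [t] := rfl

@[simp] theorem toList_cons (t : ATree B) (ts : ATreeList B) :
    (cons t ts).toList = t :: ts.toList := rfl

@[simp] theorem toList_glue (xs : List (ATree B)) (ys : ATreeList B) :
    (glue xs ys).toList = xs ++ ys.toList := by
  induction xs with
  | nil => rfl
  | cons x xs ih => simp [glue, ih]

@[simp] theorem toList_ofList (t : ATree B) (xs : List (ATree B)) :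
    (ofList t xs).toList = t :: xs := by
  induction xs generalizing t with
  | nil => rfl
  | cons x xs ih => simp [ofList, ih]

@[simp] theorem toList_map (f : ATree B → ATree B) :
    ∀ ts : ATreeList B, (ts.map f).toList = ts.toList.map f
  | .single _ => rfl
  | .cons t ts => by simp [map, toList_map f ts]

end ATreeList

open ATreeList

/-- Induction on attack trees, with the hypothesis available for all arguments of a node. -/
theorem ATree.induction_on_args {B : Type} {P : ATree B → Prop}
    (atom : ∀ b, P (.atom b))
    (or : ∀ ts : ATreeList B, (∀ t ∈ ts.toList, P t) → P (.or ts))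
    (and : ∀ ts : ATreeList B, (∀ t ∈ ts.toList, P t) → P (.and ts)) (t : ATree B) : P t :=
  ATree.rec (motive_1 := P) (motive_2 := fun ts => ∀ t ∈ ts.toList, P t) atom or and
    (fun t h => by simpa using h) (fun t ts h hs => by simpa using ⟨h, hs⟩) t

section Semantics

variable {B : Type}

theorem mem_amsemOr {M : Multiset B} :
    ∀ {ts : ATreeList B}, M ∈ amsemOr ts ↔ ∃ t ∈ ts.toList, M ∈ amsem t
  | .single t => by simp [amsemOr]
  | .cons t ts => by simp [amsemOr, mem_amsemOr (ts := ts)]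

theorem amsemAnd_cons (t : ATree B) (ts : ATreeList B) :
    amsemAnd (.cons t ts) = amsem t + amsemAnd ts := by
  ext M
  simp only [amsemAnd, Set.mem_ofPred_eq, Set.mem_add, eq_comm]

theorem amsemAnd_eq_sum : ∀ ts : ATreeList B, amsemAnd ts = (ts.toList.map amsem).sum
  | .single t => by simp [amsemAnd]
  | .cons t ts => by simp [amsemAnd_cons, amsemAnd_eq_sum ts]

theorem amsemAnd_glue (xs : List (ATree B)) (ys : ATreeList B) :
    amsemAnd (glue xs ys) = (xs.map amsem).sum + amsemAnd ys := by
  simp [amsemAnd_eq_sum]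

theorem DerivASM.sound {t t' : ATree B} (h : DerivASM t t') : amsem t = amsem t' := by
  refine DerivASM.rec (motive_1 := fun t t' _ => amsem t = amsem t')
    (motive_2 := fun ts ts' _ => amsemOr ts = amsemOr ts' ∧ amsemAnd ts = amsemAnd ts')
    ?_ ?_ ?_ ?_ ?_ ?_ ?_ ?_ ?_ ?_ ?_ ?_ ?_ ?_ ?_ h
  · exact fun _ => rfl
  · exact fun _ h => h.symm
  · exact fun _ _ h₁ h₂ => h₁.trans h₂
  · exact fun _ h => by simpa [amsem] using h.1
  · exact fun _ h => by simpa [amsem] using h.2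
  · intro ts ts' h
    ext M
    simp [amsem, mem_amsemOr, h.mem_iff]
  · intro ts ts' h
    simpa [amsem, amsemAnd_eq_sum] using (h.map amsem).sum_eq
  · intro xs ys
    ext M
    simp [amsem, mem_amsemOr, or_and_right, exists_or]
  · intro xs ys
    simp [amsem, amsemAnd_glue, amsemAnd]
  · exact fun t => by simp [amsem, amsemOr]
  · exact fun t => by simp [amsem, amsemAnd]
  · intro xs ys
    ext M
    simp only [amsem, amsemAnd_glue, amsemAnd, mem_amsemOr, Set.mem_add, toList_map,
      List.mem_map, exists_exists_and_eq_and]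
    grind
  · intro a xs
    ext M
    simp [amsem, mem_amsemOr]
  · exact fun _ h => by simpa [amsemOr, amsemAnd] using h
  · exact fun _ _ h hs => by simp [amsemOr, amsemAnd, h, hs.1, hs.2]

end Semantics

namespace DerivASM

variable {B : Type}

theorem or_pair_congr {x x' y y' : ATree B} (hx : DerivASM x x') (hy : DerivASM y y') :
    DerivASM (.or (.cons x (.single y))) (.or (.cons x' (.single y'))) :=
  .congrOr (.cons hx (.single hy))

theorem or_cons (x : ATree B) (ts : ATreeList B) :
    DerivASM (.or (.cons x (.single (.or ts)))) (.or (.cons x ts)) :=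
  .ax3 [x] ts

theorem or_pair_comm (x y : ATree B) :
    DerivASM (.or (.cons x (.single y))) (.or (.cons y (.single x))) :=
  .ax1 (List.Perm.swap _ _ _)

theorem or_pair_assoc (x y z : ATree B) :
    DerivASM (.or (.cons (.or (.cons x (.single y))) (.single z)))
      (.or (.cons x (.single (.or (.cons y (.single z)))))) :=
  (or_pair_comm _ _).trans <| (or_cons z _).trans <|
    .trans (.ax1 (ts' := .cons x (.cons y (.single z))) (List.perm_append_comm (l₁ := [z])))
      (or_cons x _).symm

/-- The preorder induced by the derivably idempotent, commutative and associative `OR`. -/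
def Le (x y : ATree B) : Prop := DerivASM (.or (.cons x (.single y))) y

theorem Le.trans {x y z : ATree B} (h₁ : Le x y) (h₂ : Le y z) : Le x z :=
  (or_pair_congr (.refl x) h₂.symm).trans <| (or_pair_assoc x y z).symm.trans <|
    (or_pair_congr h₁ (.refl z)).trans h₂

theorem Le.antisymm {x y : ATree B} (h₁ : Le x y) (h₂ : Le y x) : DerivASM x y :=
  h₂.symm.trans <| (or_pair_comm y x).trans h₁

theorem Le.congr {x x' y y' : ATree B} (hx : DerivASM x x') (hy : DerivASM y y')
    (h : Le x y) : Le x' y' :=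
  (or_pair_congr hx.symm hy.symm).trans <| DerivASM.trans h hy

theorem Le.of_deriv {x y : ATree B} (h : DerivASM x y) : Le x y :=
  (or_pair_congr h (.refl y)).trans <| (ax11 y []).trans (ax5 y)

theorem or_le {q : ATree B} :
    ∀ {ts : ATreeList B}, (∀ t ∈ ts.toList, Le t q) → Le (.or ts) q
  | .single t, h => (h t (by simp)).congr (ax5 t).symm (.refl q)
  | .cons t ts, h =>
    have hts : Le (.or ts) q := or_le fun u hu => h u (by simp [hu])
    Le.congr (or_cons t ts) (.refl q) <| (or_pair_assoc t _ q).trans <|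
      (or_pair_congr (.refl t) hts).trans (h t (by simp))

theorem le_or {x : ATree B} {ts : ATreeList B} (h : x ∈ ts.toList) : Le x (.or ts) := by
  obtain ⟨l, hl⟩ : ∃ l, ts.toList.Perm (x :: l) := by
    obtain ⟨l₁, l₂, e⟩ := List.append_of_mem h
    exact ⟨l₁ ++ l₂, e ▸ List.perm_middle⟩
  have e : DerivASM (.or ts) (.or (ofList x l)) := .ax1 (by simpa using hl)
  exact Le.congr (.refl x) e.symm <| (or_cons x _).trans (ax11 x l)

/-- To bound a conjunction `AND(cs, t)` it suffices to bound the conjunctions of `cs` with the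
multisets in the semantics of `t`. -/
theorem and_le_of_forall_mem (q t : ATree B) : ∀ cs : List (ATree B),
    (∀ M ∈ amsem t, ∀ ys : ATreeList B,
      ys.toList.Perm (cs ++ M.toList.map .atom) → Le (.and ys) q) →
    ∀ ys : ATreeList B, ys.toList.Perm (cs ++ [t]) → Le (.and ys) q := by
  induction t using ATree.induction_on_args with
  | atom b => exact fun cs h ys hys => h {b} (by simp [amsem]) ys (by simpa using hys)
  | or ts ih =>
    intro cs h ys hys
    have e : DerivASM (.and ys) (.and (glue cs (.single (.or ts)))) := .ax2 (by simpa using hys)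
    refine Le.congr (e.trans (ax10 cs ts)).symm (.refl q) (or_le fun u hu => ?_)
    obtain ⟨y, hy, rfl⟩ : ∃ y ∈ ts.toList, .and (glue cs (.single y)) = u := by simpa using hu
    exact ih y hy cs (fun M hM => h M (mem_amsemOr.2 ⟨y, hy, hM⟩)) _ (by simp)
  | and ts ih =>
    have key : ∀ (ts : ATreeList B), (∀ t ∈ ts.toList, ∀ cs : List (ATree B),
        (∀ M ∈ amsem t, ∀ ys : ATreeList B,
          ys.toList.Perm (cs ++ M.toList.map .atom) → Le (.and ys) q) →
        ∀ ys : ATreeList B, ys.toList.Perm (cs ++ [t]) → Le (.and ys) q) →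
        ∀ cs : List (ATree B), (∀ M ∈ amsemAnd ts, ∀ ys : ATreeList B,
          ys.toList.Perm (cs ++ M.toList.map .atom) → Le (.and ys) q) →
        ∀ ys : ATreeList B, ys.toList.Perm (cs ++ ts.toList) → Le (.and ys) q := by
      intro ts
      induction ts using ATreeList.rec (motive_1 := fun _ => True) with
      | atom | or | and => trivial
      | single t _ => exact fun ih => ih t (by simp)
      | cons t ts _ ihts =>
        intro ih cs h ys hys
        refine ih t (by simp) (cs ++ ts.toList) (fun M hM zs hzs => ?_) ys
          (hys.trans (by simpa using
            (List.perm_append_comm (l₁ := [t]) (l₂ := ts.toList)).append_left cs))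
        refine ihts (fun u hu => ih u (by simp [hu])) (cs ++ M.toList.map .atom)
          (fun N hN ws hws => ?_) zs
          (hzs.trans (by simpa using
            (List.perm_append_comm (l₁ := ts.toList) (l₂ := M.toList.map .atom)).append_left cs))
        refine h (M + N) ⟨M, hM, N, hN, rfl⟩ ws (hws.trans ?_)
        rw [List.append_assoc, ← List.map_append]
        exact ((Multiset.coe_eq_coe.1 (by simp [← Multiset.coe_add])).map _).append_left cs
    intro cs h ys hys
    have e : DerivASM (.and ys) (.and (glue cs (.single (.and ts)))) := .ax2 (by simpa using hys)
    exact Le.congr (e.trans (ax4 cs ts)).symm (.refl q) (key ts ih cs h _ (by simp))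

/-- The conjunction of `cs` with a multiset in the semantics of `t` is below `AND(cs, t)`. -/
theorem and_le_and_of_mem (t : ATree B) : ∀ (cs : List (ATree B)), ∀ M ∈ amsem t,
    ∀ ys zs : ATreeList B, ys.toList.Perm (cs ++ M.toList.map .atom) →
      zs.toList.Perm (cs ++ [t]) → Le (.and ys) (.and zs) := by
  induction t using ATree.induction_on_args with
  | atom b =>
    intro cs M hM ys zs hys hzs
    obtain rfl : M = {b} := hM
    exact .of_deriv (.ax2 (hys.trans (by simpa using hzs.symm)))
  | or ts ih =>
    intro cs M hM ys zs hys hzs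
    obtain ⟨y, hy, hM⟩ := mem_amsemOr.1 hM
    have e : DerivASM (.and zs) (.and (glue cs (.single (.or ts)))) := .ax2 (by simpa using hzs)
    refine Le.congr (.refl _) (e.trans (ax10 cs ts)).symm ?_
    refine (ih y hy cs M hM ys (glue cs (.single y)) hys (by simp)).trans (le_or ?_)
    simpa using ⟨y, hy, rfl⟩
  | and ts ih =>
    have key : ∀ (ts : ATreeList B), (∀ t ∈ ts.toList, ∀ (cs : List (ATree B)), ∀ M ∈ amsem t,
        ∀ ys zs : ATreeList B, ys.toList.Perm (cs ++ M.toList.map .atom) →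
          zs.toList.Perm (cs ++ [t]) → Le (.and ys) (.and zs)) →
        ∀ (cs : List (ATree B)), ∀ M ∈ amsemAnd ts,
        ∀ ys zs : ATreeList B, ys.toList.Perm (cs ++ M.toList.map .atom) →
          zs.toList.Perm (cs ++ ts.toList) → Le (.and ys) (.and zs) := by
      intro ts
      induction ts using ATreeList.rec (motive_1 := fun _ => True) with
      | atom | or | and => trivial
      | single t _ => exact fun ih => ih t (by simp)
      | cons t ts _ ihts =>
        rintro ih cs _ ⟨M, hM, N, hN, rfl⟩ ys zs hys hzs
        have hMN : ys.toList.Perm ((cs ++ M.toList.map .atom) ++ N.toList.map .atom) := by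
          refine hys.trans ?_
          rw [List.append_assoc, ← List.map_append]
          exact ((Multiset.coe_eq_coe.1 (by simp [← Multiset.coe_add])).map _).append_left cs
        refine (ihts (fun u hu => ih u (by simp [hu])) _ N hN ys
          (glue (cs ++ M.toList.map .atom) ts) hMN (by simp)).trans ?_
        exact ih t (by simp) (cs ++ ts.toList) M hM _ zs
          (by simpa using
            (List.perm_append_comm (l₁ := M.toList.map .atom) (l₂ := ts.toList)).append_left cs)
          (hzs.trans (by simpa using
            (List.perm_append_comm (l₁ := [t]) (l₂ := ts.toList)).append_left cs))
    intro cs M hM ys zs hys hzs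
    have e : DerivASM (.and zs) (.and (glue cs (.single (.and ts)))) := .ax2 (by simpa using hzs)
    exact Le.congr (.refl _) (e.trans (ax4 cs ts)).symm (key ts ih cs M hM ys _ hys (by simp))

theorem Le.of_amsem_subset {t t' : ATree B} (h : amsem t ⊆ amsem t') : Le t t' :=
  Le.congr (ax6 t) (ax6 t') <|
    and_le_of_forall_mem _ t []
      (fun M hM ys hys => and_le_and_of_mem t' [] M (h hM) ys _ hys (by simp)) _ (by simp)

end DerivASM

/-- Theorem 3: `E_SM` is a complete set of axioms for the
multiset semantics for standard attack trees: `⟦t⟧_M = ⟦t'⟧_M` iff `t = t'` is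
a syntactic consequence of `E_SM`. -/
theorem ESM_complete (B : Type) (t t' : ATree B) : amsem t = amsem t' ↔ DerivASM t t' :=
  ⟨fun h => DerivASM.Le.antisymm (.of_amsem_subset h.subset) (.of_amsem_subset h.superset),
    DerivASM.sound⟩
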